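/- arXiv:math/9805034 — 2 statements merged into one kernel-verified Lean document; each statement's English description precedes it below -/
import Mathlib

section
/- Let m ≥ 2 and G = gl(m|1), acting on V via ρ, and let E_{ij} (1 ≤ i,j ≤ m+1) denote the standard matrix units. Define bilinear maps g₁, g₂, g₃ : G×G → V by g₁(E_{ij}, E_{m+1,k}) = −g₁(E_{m+1,k}, E_{ij}) = δ_{ik} η_j, g₂(E_{ij}, E_{m+1,k}) = −g₂(E_{m+1,k}, E_{ij}) = δ_{ij} η_k, g₃(E_{m+1,m+1}, E_{m+1,k}) = −g₃(E_{m+1,k}, E_{m+1,m+1}) = η_k, for i,j,k ∈ {1,…,m}, with value zero on all other pairs of standard matrix units, where η_k = ι_{e_k*}(e₁∧⋯∧e_m) ∈ V₁. Then g₁, g₂, g₃ form a basis of the space of bilinear maps g : G×G → V that are super-skew-symmetric (g(B,A) = −(−1)^{|A||B|} g(A,B) for homogeneous A,B) and G₀-invariant, i.e. ρ(C)(g(A,B)) = g(⟨C,A⟩, B) + g(A, ⟨C,B⟩) for every even C ∈ G and all A,B ∈ G. -/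
open ExteriorAlgebra

open Matrix

variable (K : Type) [Field K]

/-- The space of matrices underlying `gl(m|n)`. -/
abbrev gl (m n : ℕ) : Type := Matrix (Fin (m + n)) (Fin (m + n)) K

/-- The parity of an index: indices `< m` are even, the rest odd. -/
def par (m n : ℕ) (i : Fin (m + n)) : ZMod 2 := if (i : ℕ) < m then 0 else 1

/-- `A` is homogeneous of parity `p`. -/
def IsHom {m n : ℕ} (p : ZMod 2) (A : gl K m n) : Prop :=
  ∀ i j, A i j ≠ 0 → par m n i + par m n j = p

/-- The sign `(-1)^p` for `p : ZMod 2`. -/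
def sg (p : ZMod 2) : K := if p = 0 then 1 else -1

/-- The even (block-diagonal) part of a matrix. -/
def evenP {m n : ℕ} (A : gl K m n) : gl K m n :=
  Matrix.of fun i j => if par m n i = par m n j then A i j else 0

/-- The odd (block-off-diagonal) part of a matrix. -/
def oddP {m n : ℕ} (A : gl K m n) : gl K m n :=
  Matrix.of fun i j => if par m n i = par m n j then 0 else A i j

/-- The super bracket `⟨A,B⟩ = AB - (-1)^{|A||B|} BA` on homogeneous elements,
extended bilinearly to all of `gl(m|n)`. -/
def sbr {m n : ℕ} (A B : gl K m n) : gl K m n :=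
  A * B - evenP K B * A - oddP K B * evenP K A + oddP K B * oddP K A

/-- The supertrace `Str(A) = Tr(a) - Tr(d)`. -/
def str {m n : ℕ} (A : gl K m n) : K := ∑ i, sg K (par m n i) * A i i

/-- `sl(m|n)`, the subspace of supertraceless matrices, as a submodule of `gl(m|n)`. -/
def sl (m n : ℕ) : Submodule K (gl K m n) where
  carrier := {A | str K A = 0}
  add_mem' {A B} hA hB := by
    simp only [Set.mem_setOf_eq, str] at *
    simp [Matrix.add_apply, mul_add, Finset.sum_add_distrib, hA, hB]
  zero_mem' := by simp [str]
  smul_mem' c A hA := by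
    simp only [Set.mem_setOf_eq, str] at *
    simp only [Matrix.smul_apply, smul_eq_mul, mul_left_comm, ← Finset.mul_sum, hA, mul_zero]

/-- The exterior algebra `Λ(E)` over `E = 𝕂^m`. -/
abbrev ExtAlg (m : ℕ) : Type := ExteriorAlgebra K (Fin m → K)

/-- The ambient space carrying `V = ⊕_{r=1}^m V_r`: an `m`-tuple of elements of `Λ(E)`,
the component indexed by `r : Fin m` standing for the piece `V_{r+1} = ⋀^{m-1-r} E`. -/
abbrev Wam (m : ℕ) : Type := Fin m → ExtAlg K m

/-- Left exterior multiplication `ω ↦ v ∧ ω` by a vector `v ∈ E`. -/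
def wmul {m : ℕ} (v : Fin m → K) : ExtAlg K m →ₗ[K] ExtAlg K m :=
  LinearMap.mulLeft K (ExteriorAlgebra.ι K v)

/-- Contraction (interior product) `ι_y` by a covector `y ∈ E*`. -/
def ctr {m : ℕ} (y : Module.Dual K (Fin m → K)) : ExtAlg K m →ₗ[K] ExtAlg K m :=
  CliffordAlgebra.contractLeft y

/-- The derivation action `θ_a` of a matrix `a ∈ M_m(𝕂)` on the exterior algebra,
`θ_a (v₁ ∧ … ∧ v_k) = Σᵢ v₁ ∧ … ∧ (a vᵢ) ∧ … ∧ v_k`; concretely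
`θ_a = Σ_{i,j} a_{ij} (e_i ∧ -) ∘ ι_{e_j*}`. -/
def theta {m : ℕ} (a : Matrix (Fin m) (Fin m) K) : ExtAlg K m →ₗ[K] ExtAlg K m :=
  ∑ i, ∑ j, a i j • (wmul K (Pi.single i 1) ∘ₗ ctr K (LinearMap.proj j))

/-- The upper-left `m×m` block `a` of `A ∈ gl(m|1)`. -/
def blka {m : ℕ} (A : gl K m 1) : Matrix (Fin m) (Fin m) K :=
  Matrix.of fun i j => A (Fin.castSucc i) (Fin.castSucc j)

/-- The upper-right column `x` of `A ∈ gl(m|1)`. -/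
def blkx {m : ℕ} (A : gl K m 1) : Fin m → K :=
  fun i => A (Fin.castSucc i) (Fin.last m)

/-- The lower-left row `y` of `A ∈ gl(m|1)`, as a covector. -/
def blky {m : ℕ} (A : gl K m 1) : Module.Dual K (Fin m → K) :=
  ∑ j, A (Fin.last m) (Fin.castSucc j) • (LinearMap.proj j :  (Fin m → K) →ₗ[K] K)

/-- The lower-right entry `d` of `A ∈ gl(m|1)`. -/
def blkd {m : ℕ} (A : gl K m 1) : K := A (Fin.last m) (Fin.last m)

/-- Component `r` of the action `ρ(A)` on `V = ⊕_{r=1}^m V_r` (slot `r` standing for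
`V_{r+1}`, `r = 0, …, m-1`): on `ω ∈ V_r` (paper numbering `r = 1, …, m`) it is
`θ_a ω - (Tr a) ω + r d ω` into `V_r`, plus `(r-1)(x ∧ ω)` into `V_{r-1}`, plus
`ι_y ω` into `V_{r+1}`. -/
def rhoComp {m : ℕ} (A : gl K m 1) (r : Fin m) : Wam K m →ₗ[K] ExtAlg K m :=
  (theta K (blka K A) - (Matrix.trace (blka K A)) • LinearMap.id
      + ((((r : ℕ) + 1 : ℕ) : K) * blkd K A) • LinearMap.id) ∘ₗ LinearMap.proj r
    + (if h : (r : ℕ) + 1 < m then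
        ((((r : ℕ) + 1 : ℕ) : K) • (wmul K (blkx K A) ∘ₗ LinearMap.proj (⟨(r : ℕ) + 1, h⟩ : Fin m)))
      else 0)
    + (if _h : 0 < (r : ℕ) then
        (ctr K (blky K A) ∘ₗ
          LinearMap.proj (⟨(r : ℕ) - 1, lt_of_le_of_lt (Nat.sub_le _ 1) r.isLt⟩ : Fin m))
      else 0)

/-- The representation `ρ` of `gl(m|1)` on (the ambient space of) `V`. -/
def rho {m : ℕ} (A : gl K m 1) : Wam K m →ₗ[K] Wam K m :=
  LinearMap.pi (rhoComp K A)

/-- The submodule `V = ⊕_{r=1}^m V_r` with `V_r = ⋀^{m-r} E`. -/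
def Vsub (m : ℕ) : Submodule K (Wam K m) :=
  Submodule.pi Set.univ fun r => ⋀[K]^(m - 1 - (r : ℕ)) (Fin m → K)

/-- The parity-`p` part of `V`: the sum of those `V_r` with `(m - r) % 2 = p`. -/
def Vpart (m : ℕ) (p : ZMod 2) : Submodule K (Wam K m) :=
  Submodule.pi Set.univ fun r =>
    if ((m - 1 - (r : ℕ) : ℕ) : ZMod 2) = p then ⋀[K]^(m - 1 - (r : ℕ)) (Fin m → K) else ⊥

/-- The top wedge `e₁ ∧ e₂ ∧ … ∧ e_m ∈ ⋀^m E`. -/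
def topWedge (m : ℕ) : ExtAlg K m :=
  (List.ofFn fun i : Fin m => ExteriorAlgebra.ι K (Pi.single i (1 : K))).prod

/-- `η_k = ι_{e_k*}(e₁ ∧ … ∧ e_m) ∈ ⋀^{m-1} E`. -/
def eta {m : ℕ} (k : Fin m) : ExtAlg K m :=
  ctr K (LinearMap.proj k) (topWedge K m)
/-- The bilinear map `g₁` determined by `g₁(E_{ij}, E_{m+1,k}) = -g₁(E_{m+1,k}, E_{ij})
 = δ_{ik} η_j` (`i,j,k ∈ {1,…,m}`) and zero on the other pairs of matrix units, where
`η_j = ι_{e_j*}(e₁∧⋯∧e_m) ∈ V₁` (slot `0`). -/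
def g1 (m : ℕ) (hm : 0 < m) (A B : gl K m 1) : Wam K m :=
  Pi.single (⟨0, hm⟩ : Fin m)
    (∑ j, (∑ i, (A (Fin.castSucc i) (Fin.castSucc j) * B (Fin.last m) (Fin.castSucc i)
        - B (Fin.castSucc i) (Fin.castSucc j) * A (Fin.last m) (Fin.castSucc i))) • eta K j)

/-- The bilinear map `g₂` determined by `g₂(E_{ij}, E_{m+1,k}) = -g₂(E_{m+1,k}, E_{ij})
 = δ_{ij} η_k` and zero on the other pairs of matrix units. -/
def g2 (m : ℕ) (hm : 0 < m) (A B : gl K m 1) : Wam K m :=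
  Pi.single (⟨0, hm⟩ : Fin m)
    (∑ k, (Matrix.trace (blka K A) * B (Fin.last m) (Fin.castSucc k)
        - Matrix.trace (blka K B) * A (Fin.last m) (Fin.castSucc k)) • eta K k)

/-- The bilinear map `g₃` determined by `g₃(E_{m+1,m+1}, E_{m+1,k}) = -g₃(E_{m+1,k}, E_{m+1,m+1})
 = η_k` and zero on the other pairs of matrix units. -/
def g3 (m : ℕ) (hm : 0 < m) (A B : gl K m 1) : Wam K m :=
  Pi.single (⟨0, hm⟩ : Fin m)
    (∑ k, (blkd K A * B (Fin.last m) (Fin.castSucc k)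
        - blkd K B * A (Fin.last m) (Fin.castSucc k)) • eta K k)


section ExteriorCalculus

variable {K} {m : ℕ}

lemma ctr_wmul (y : Module.Dual K (Fin m → K)) (v : Fin m → K) (w : ExtAlg K m) :
    ctr K y (wmul K v w) = y v • w - wmul K v (ctr K y w) :=
  CliffordAlgebra.contractLeft_ι_mul y v w

lemma ctr_ctr (y : Module.Dual K (Fin m → K)) (w : ExtAlg K m) : ctr K y (ctr K y w) = 0 :=
  CliffordAlgebra.contractLeft_contractLeft y w

lemma ctr_comm (y z : Module.Dual K (Fin m → K)) (w : ExtAlg K m) :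
    ctr K y (ctr K z w) = -ctr K z (ctr K y w) :=
  CliffordAlgebra.contractLeft_comm y z w

lemma wmul_wmul_swap (u v : Fin m → K) (w : ExtAlg K m) :
    wmul K u (wmul K v w) = -wmul K v (wmul K u w) := by
  have h := ExteriorAlgebra.ι_add_mul_swap (R := K) u v
  simp only [wmul, LinearMap.mulLeft_apply, ← mul_assoc]
  rw [eq_neg_of_add_eq_zero_left h, neg_mul]

lemma wmul_mem {n : ℕ} (v : Fin m → K) {w : ExtAlg K m} (hw : w ∈ ⋀[K]^n (Fin m → K)) :
    wmul K v w ∈ ⋀[K]^(n + 1) (Fin m → K) := by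
  rw [exteriorPower, pow_succ']
  exact Submodule.mul_mem_mul (LinearMap.mem_range_self _ v) hw

lemma ctr_mem {n : ℕ} (y : Module.Dual K (Fin m → K)) {w : ExtAlg K m}
    (hw : w ∈ ⋀[K]^n (Fin m → K)) : ctr K y w ∈ ⋀[K]^(n - 1) (Fin m → K) := by
  suffices h : ctr K y w ∈ ⋀[K]^(n - 1) (Fin m → K) ∧ (n = 0 → ctr K y w = 0) from h.1
  refine Submodule.pow_induction_on_left' _
    (C := fun n w _ => ctr K y w ∈ ⋀[K]^(n - 1) (Fin m → K) ∧ (n = 0 → ctr K y w = 0))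
    (fun r => ?_) (fun a b i _ _ ha hb => ?_) ?_ hw
  · have : ctr K y (algebraMap K (ExtAlg K m) r) = 0 :=
      CliffordAlgebra.contractLeft_algebraMap _ _ r
    simp [this]
  · refine ⟨by rw [map_add]; exact add_mem ha.1 hb.1, fun h => ?_⟩
    rw [map_add, ha.2 h, hb.2 h, add_zero]
  · rintro _ ⟨v, rfl⟩ i x hx ⟨h1, h2⟩
    refine ⟨?_, fun h => absurd h (Nat.succ_ne_zero i)⟩
    change ctr K y (wmul K v x) ∈ _
    rw [ctr_wmul]
    refine sub_mem (Submodule.smul_mem _ _ hx) ?_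
    rcases i with _ | i
    · rw [h2 rfl, map_zero]; exact zero_mem _
    · exact wmul_mem v h1

lemma sum_wmul_ctr {n : ℕ} {w : ExtAlg K m} (hw : w ∈ ⋀[K]^n (Fin m → K)) :
    ∑ l, wmul K (Pi.single l 1) (ctr K (LinearMap.proj l) w) = (n : K) • w := by
  refine Submodule.pow_induction_on_left' _
    (C := fun n w _ => ∑ l, wmul K (Pi.single l 1) (ctr K (LinearMap.proj l) w) = (n : K) • w)
    (fun r => ?_) (fun a b i _ _ ha hb => ?_) ?_ hw
  · have (l : Fin m) : ctr K (LinearMap.proj l) (algebraMap K (ExtAlg K m) r) = 0 :=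
      CliffordAlgebra.contractLeft_algebraMap _ _ r
    simp [this]
  · simp only [map_add, Finset.sum_add_distrib, ha, hb, smul_add]
  · rintro _ ⟨v, rfl⟩ i x hx h
    change ∑ l, wmul K (Pi.single l 1) (ctr K (LinearMap.proj l) (wmul K v x)) =
      _ • wmul K v x
    have hv : ∑ l, v l • wmul K (Pi.single l 1) x = wmul K v x := by
      have : v = ∑ l, v l • (Pi.single l 1 : Fin m → K) := by
        simpa using (pi_eq_sum_univ' v)
      conv_rhs => rw [this]
      simp [wmul, Finset.sum_mul]
    simp only [ctr_wmul, map_sub, map_smul, wmul_wmul_swap _ v, sub_neg_eq_add,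
      Finset.sum_add_distrib, ← map_sum, h, LinearMap.proj_apply, hv]
    rw [Nat.cast_succ, add_smul, one_smul, add_comm]

lemma topWedge_eq_ιMulti :
    topWedge K m = ExteriorAlgebra.ιMulti K m fun i : Fin m => (Pi.single i 1 : Fin m → K) :=
  (ExteriorAlgebra.ιMulti_apply _).symm

lemma topWedge_mem : topWedge K m ∈ ⋀[K]^m (Fin m → K) := by
  rw [topWedge_eq_ιMulti]
  exact ExteriorAlgebra.ιMulti_range K m (Set.mem_range_self _)

lemma topWedge_ne_zero : topWedge K m ≠ 0 := by
  intro h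
  have := ExteriorAlgebra.liftAlternating_apply_ιMulti (R := K)
    (fun i => if hi : i = m then (Pi.basisFun K (Fin m)).det.domDomCongr (finCongr hi.symm) else 0)
    (fun i : Fin m => (Pi.single i 1 : Fin m → K))
  rw [← topWedge_eq_ιMulti, h, map_zero] at this
  have h1 := (Pi.basisFun K (Fin m)).det_self
  have h2 : (⇑(Pi.basisFun K (Fin m)) : Fin m → Fin m → K) = fun i => Pi.single i 1 := by
    ext i; simp
  rw [h2] at h1
  exact zero_ne_one (α := K) (this.trans (by simpa using h1))

lemma exists_smul_topWedge {w : ExtAlg K m} (hw : w ∈ ⋀[K]^m (Fin m → K)) :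
    ∃ c : K, w = c • topWedge K m := by
  rw [← ExteriorAlgebra.ιMulti_span_fixedDegree] at hw
  suffices h : Submodule.span K (Set.range (ExteriorAlgebra.ιMulti K m)) ≤
      Submodule.span K {topWedge K m} by
    obtain ⟨c, hc⟩ := Submodule.mem_span_singleton.1 (h hw)
    exact ⟨c, hc.symm⟩
  rw [Submodule.span_le]
  rintro _ ⟨v, rfl⟩
  set b := Pi.basisFun K (Fin m)
  have hb : ExteriorAlgebra.ιMulti K m v = b.det v • ExteriorAlgebra.ιMulti K m b := by
    suffices h : ExteriorAlgebra.ιMulti K m = (LinearMap.toSpanSingleton K _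
        (ExteriorAlgebra.ιMulti K m b)).compAlternatingMap b.det by
      simpa using congrArg (fun f => f v) h
    refine b.ext_alternating fun s hs => ?_
    let σ : Equiv.Perm (Fin m) := Equiv.ofBijective s (Finite.injective_iff_bijective.1 hs)
    change ExteriorAlgebra.ιMulti K m (b ∘ σ) = b.det (b ∘ σ) • ExteriorAlgebra.ιMulti K m b
    simp only [AlternatingMap.map_perm, Module.Basis.det_self, smul_assoc, one_smul]
  refine Submodule.mem_span_singleton.2 ⟨b.det v, ?_⟩
  rw [hb, topWedge_eq_ιMulti]
  congr 2
  ext i; simp [b]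

lemma wmul_topWedge (i : Fin m) : wmul K (Pi.single i 1) (topWedge K m) = 0 := by
  rw [topWedge_eq_ιMulti]
  have := ExteriorAlgebra.ιMulti_succ_apply (R := K)
    (Fin.cons (Pi.single i 1) fun i : Fin m => (Pi.single i 1 : Fin m → K) :
      Fin (m + 1) → Fin m → K)
  rw [ExteriorAlgebra.ιMulti_eq_zero_of_not_inj] at this
  · exact this.symm
  · intro h
    exact Fin.succ_ne_zero i (@h i.succ 0 (by simp))

lemma eta_mem (k : Fin m) : eta K k ∈ ⋀[K]^(m - 1) (Fin m → K) := ctr_mem _ topWedge_mem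

lemma wmul_eta (i j : Fin m) :
    wmul K (Pi.single i 1) (eta K j) = if i = j then topWedge K m else 0 := by
  have h := ctr_wmul (LinearMap.proj j) (Pi.single i 1) (topWedge K m)
  rw [wmul_topWedge, map_zero, eq_comm, sub_eq_zero] at h
  rw [eta, ← h]
  simp [Pi.single_apply, eq_comm]

lemma eta_ne_zero (k : Fin m) : eta K k ≠ 0 := fun h =>
  topWedge_ne_zero (K := K) (m := m) (by simpa [h] using (wmul_eta (K := K) k k).symm)

lemma theta_eta (a : Matrix (Fin m) (Fin m) K) (k : Fin m) :
    theta K a (eta K k) = Matrix.trace a • eta K k - ∑ j, a k j • eta K j := by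
  have h (i j : Fin m) : wmul K (Pi.single i 1) (ctr K (LinearMap.proj j) (eta K k)) =
      (if i = j then eta K k else 0) - if i = k then eta K j else 0 := by
    have h1 := ctr_wmul (LinearMap.proj k) (Pi.single i 1) (eta K j)
    rw [wmul_eta] at h1
    rw [eta, ctr_comm, map_neg, ← eta, neg_eq_iff_eq_neg, neg_sub, ← eta]
    rw [eq_sub_iff_add_eq, ← eq_sub_iff_add_eq'] at h1
    rw [h1]
    split_ifs <;> simp_all [eta, Pi.single_apply, eq_comm]
  simp only [theta, LinearMap.sum_apply, LinearMap.smul_apply, LinearMap.comp_apply, h, smul_sub,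
    Finset.sum_sub_distrib]
  simp [Matrix.trace, Finset.sum_smul]

lemma theta_single (i j : Fin m) (w : ExtAlg K m) :
    theta K (Matrix.single i j 1) w = wmul K (Pi.single i 1) (ctr K (LinearMap.proj j) w) := by
  rw [theta, Finset.sum_eq_single i (fun k _ hk => ?_) (by simp),
    Finset.sum_eq_single j (fun l _ hl => ?_) (by simp)]
  · simp
  · rw [Matrix.single_apply_of_col_ne _ _ hl.symm, zero_smul]
  · exact Finset.sum_eq_zero fun l _ => by
      rw [Matrix.single_apply_of_row_ne hk.symm, zero_smul]

lemma theta_single_idem (i : Fin m) (w : ExtAlg K m) :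
    theta K (Matrix.single i i 1) (theta K (Matrix.single i i 1) w) =
      theta K (Matrix.single i i 1) w := by
  simp [theta_single, ctr_wmul, ctr_ctr]

lemma exists_smul_eta (hm : 0 < m) (k : Fin m) {w : ExtAlg K m}
    (hw : w ∈ ⋀[K]^(m - 1) (Fin m → K))
    (h : ∀ l, l ≠ k → theta K (Matrix.single l l 1) w = w) : ∃ c : K, w = c • eta K k := by
  have h1 := sum_wmul_ctr hw
  simp only [← theta_single] at h1
  rw [← Finset.add_sum_erase _ _ (Finset.mem_univ k),
    Finset.sum_congr rfl fun l hl => h l (Finset.ne_of_mem_erase hl)] at h1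
  have h2 : theta K (Matrix.single k k 1) w = 0 := by
    simpa [Finset.card_erase_of_mem, ← Nat.cast_smul_eq_nsmul K] using h1
  have h3 := wmul_mem (Pi.single k 1) hw
  rw [Nat.sub_add_cancel hm] at h3
  obtain ⟨c, hc⟩ := exists_smul_topWedge h3
  have h4 := ctr_wmul (LinearMap.proj k) (Pi.single k 1) w
  rw [← theta_single, h2, hc] at h4
  exact ⟨c, by simpa [eta] using h4.symm⟩

end ExteriorCalculus

section EvenAction

variable {K} {m : ℕ}

/-- The lower-left row of a matrix in `gl(m|1)`, as a vector. -/
def rowy (A : gl K m 1) : Fin m → K := fun k => A (Fin.last m) (Fin.castSucc k)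

lemma par_castSucc (i : Fin m) : par m 1 (Fin.castSucc i) = 0 := by simp [par]

lemma par_last : par m 1 (Fin.last m) = 1 := by simp [par]

lemma IsHom.castSucc_last {C : gl K m 1} (hC : IsHom K 0 C) (i : Fin m) :
    C (Fin.castSucc i) (Fin.last m) = 0 := by
  by_contra h
  have := hC _ _ h
  rw [par_castSucc, par_last] at this
  exact absurd this (by decide)

lemma IsHom.last_castSucc {C : gl K m 1} (hC : IsHom K 0 C) (i : Fin m) :
    C (Fin.last m) (Fin.castSucc i) = 0 := by
  by_contra h
  have := hC _ _ h
  rw [par_castSucc, par_last] at this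
  exact absurd this (by decide)

lemma IsHom.blka_eq_zero {A : gl K m 1} (hA : IsHom K 1 A) : blka K A = 0 := by
  ext i j
  by_contra h
  have := hA _ _ h
  rw [par_castSucc, par_castSucc] at this
  exact absurd this (by decide)

lemma IsHom.blkd_eq_zero {A : gl K m 1} (hA : IsHom K 1 A) : blkd K A = 0 := by
  by_contra h
  have := hA _ _ h
  rw [par_last] at this
  exact absurd this (by decide)

lemma sbr_of_even {C : gl K m 1} (hC : IsHom K 0 C) (A : gl K m 1) :
    sbr K C A = C * A - A * C := by
  have h1 : evenP K C = C := by
    ext i j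
    by_cases h : par m 1 i = par m 1 j
    · simp [evenP, h]
    · have : C i j = 0 := by
        by_contra h'
        have h2 := hC i j h'
        rw [CharTwo.add_eq_zero] at h2
        exact h h2
      simp [evenP, h, this]
  have h2 : oddP K C = 0 := by
    ext i j
    have := congrFun (congrFun h1 i) j
    simp only [evenP, oddP, Matrix.of_apply, Matrix.zero_apply] at this ⊢
    split_ifs with h
    · rfl
    · simpa [h] using this.symm
  have h3 : evenP K A + oddP K A = A := by
    ext i j
    simp only [evenP, oddP, Matrix.add_apply, Matrix.of_apply]
    split_ifs <;> simp
  rw [sbr, h1, h2, mul_zero, add_zero]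
  rw [sub_sub, ← add_mul, h3]

lemma rho_of_even {C : gl K m 1} (hC : IsHom K 0 C) (w : Wam K m) (r : Fin m) :
    rho K C w r = theta K (blka K C) (w r) - Matrix.trace (blka K C) • w r
      + ((((r : ℕ) + 1 : ℕ) : K) * blkd K C) • w r := by
  have hx : blkx K C = 0 := funext hC.castSucc_last
  have hy : blky K C = 0 := Finset.sum_eq_zero fun i _ => by rw [hC.last_castSucc, zero_smul]
  have hw : wmul K (0 : Fin m → K) = 0 := by ext; simp [wmul]
  have hc : ctr K (0 : Module.Dual K (Fin m → K)) = 0 := by simp [ctr]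
  simp [rho, rhoComp, hx, hy, hw, hc]

lemma blka_sbr {C : gl K m 1} (hC : IsHom K 0 C) (A : gl K m 1) :
    blka K (sbr K C A) = blka K C * blka K A - blka K A * blka K C := by
  ext i j
  simp [sbr_of_even hC, blka, Matrix.mul_apply, Fin.sum_univ_castSucc, hC.castSucc_last,
    hC.last_castSucc]

lemma rowy_sbr {C : gl K m 1} (hC : IsHom K 0 C) (A : gl K m 1) :
    rowy (sbr K C A) = blkd K C • rowy A - rowy A ᵥ* blka K C := by
  ext j
  simp [sbr_of_even hC, blka, blkd, rowy, Matrix.vecMul, dotProduct, Matrix.mul_apply,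
    Fin.sum_univ_castSucc, hC.last_castSucc]

lemma blkd_sbr {C : gl K m 1} (hC : IsHom K 0 C) (A : gl K m 1) : blkd K (sbr K C A) = 0 := by
  simp [sbr_of_even hC, blkd, Matrix.mul_apply, Fin.sum_univ_castSucc, hC.castSucc_last,
    hC.last_castSucc, mul_comm]

/-- The map `𝕂^m → V₁`, `v ↦ ∑ k, v k • η_k`. -/
def etaComb (hm : 0 < m) : (Fin m → K) →ₗ[K] Wam K m :=
  LinearMap.single K (fun _ => ExtAlg K m) ⟨0, hm⟩ ∘ₗ Fintype.linearCombination K (eta K)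

lemma etaComb_apply (hm : 0 < m) (v : Fin m → K) :
    etaComb hm v = Pi.single (⟨0, hm⟩ : Fin m) (∑ k, v k • eta K k) := rfl

lemma etaComb_single (hm : 0 < m) (k : Fin m) (c : K) :
    etaComb hm (Pi.single k c) = Pi.single (⟨0, hm⟩ : Fin m) (c • eta K k) := by
  simp [etaComb]

lemma etaComb_single_ne_zero (hm : 0 < m) (k : Fin m) :
    etaComb hm (Pi.single k (1 : K)) ≠ 0 := by
  rw [etaComb_single, one_smul, Ne, Pi.single_eq_zero_iff]
  exact eta_ne_zero k

lemma etaComb_mem (hm : 0 < m) (v : Fin m → K) : etaComb hm v ∈ Vsub K m := by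
  rw [etaComb_apply]
  intro r _
  rcases eq_or_ne r ⟨0, hm⟩ with rfl | h
  · rw [Pi.single_eq_same]
    exact Submodule.sum_mem _ fun k _ => Submodule.smul_mem _ _ (eta_mem k)
  · rw [Pi.single_eq_of_ne h]
    exact zero_mem _

lemma rho_etaComb (hm : 0 < m) {C : gl K m 1} (hC : IsHom K 0 C) (v : Fin m → K) :
    rho K C (etaComb hm v) = etaComb hm (blkd K C • v - v ᵥ* blka K C) := by
  funext r
  rw [rho_of_even hC, etaComb_apply, etaComb_apply]
  rcases eq_or_ne r ⟨0, hm⟩ with rfl | h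
  · simp only [Pi.single_eq_same, map_sum, map_smul, theta_eta, Pi.sub_apply, Pi.smul_apply,
      smul_sub, sub_smul, Finset.sum_sub_distrib, Finset.smul_sum, Matrix.vecMul, dotProduct,
      Finset.sum_smul, smul_smul, smul_eq_mul]
    rw [Finset.sum_comm (f := fun k j => (v k * blka K C k j) • eta K j)]
    simp only [mul_comm, zero_add, Nat.cast_one, mul_one]
    abel
  · simp [Pi.single_eq_of_ne h]

end EvenAction

section StandardMaps

variable {K} {m : ℕ}

variable (K m) in
/-- The super-skew-symmetric `G₀`-invariant bilinear maps `G × G → V`. -/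
def invSkewMaps : Submodule K (gl K m 1 →ₗ[K] gl K m 1 →ₗ[K] Wam K m) where
  carrier := {f | (∀ A B, f A B ∈ Vsub K m) ∧
    (∀ (pA pB : ZMod 2) (A B : gl K m 1), IsHom K pA A → IsHom K pB B →
      f B A = -(sg K (pA * pB) • f A B)) ∧
    (∀ C : gl K m 1, IsHom K 0 C → ∀ A B : gl K m 1,
      rho K C (f A B) = f (sbr K C A) B + f A (sbr K C B))}
  add_mem' := by
    rintro f g ⟨hf1, hf2, hf3⟩ ⟨hg1, hg2, hg3⟩
    refine ⟨fun A B => add_mem (hf1 A B) (hg1 A B), fun pA pB A B hA hB => ?_,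
      fun C hC A B => ?_⟩
    · simp only [LinearMap.add_apply, hf2 pA pB A B hA hB, hg2 pA pB A B hA hB, smul_add, neg_add]
    · simp only [LinearMap.add_apply, map_add, hf3 C hC, hg3 C hC]
      abel
  zero_mem' := ⟨fun _ _ => zero_mem _, by simp, by simp⟩
  smul_mem' := by
    rintro c f ⟨hf1, hf2, hf3⟩
    refine ⟨fun A B => Submodule.smul_mem _ c (hf1 A B), fun pA pB A B hA hB => ?_,
      fun C hC A B => ?_⟩
    · simp only [LinearMap.smul_apply, hf2 pA pB A B hA hB, smul_neg, smul_comm c]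
    · simp only [LinearMap.smul_apply, map_smul, hf3 C hC, smul_add]

lemma g1_eq (hm : 0 < m) (A B : gl K m 1) :
    g1 K m hm A B = etaComb hm (rowy B ᵥ* blka K A - rowy A ᵥ* blka K B) := by
  simp [g1, etaComb_apply, Matrix.vecMul, dotProduct, rowy, blka, mul_comm]

lemma g2_eq (hm : 0 < m) (A B : gl K m 1) :
    g2 K m hm A B =
      etaComb hm (Matrix.trace (blka K A) • rowy B - Matrix.trace (blka K B) • rowy A) := rfl

lemma g3_eq (hm : 0 < m) (A B : gl K m 1) :
    g3 K m hm A B = etaComb hm (blkd K A • rowy B - blkd K B • rowy A) := rfl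

lemma blka_add (A B : gl K m 1) : blka K (A + B) = blka K A + blka K B := rfl
lemma blka_smul (c : K) (A : gl K m 1) : blka K (c • A) = c • blka K A := rfl
lemma rowy_add (A B : gl K m 1) : rowy (A + B) = rowy A + rowy B := rfl
lemma rowy_smul (c : K) (A : gl K m 1) : rowy (c • A) = c • rowy A := rfl
lemma blkd_add (A B : gl K m 1) : blkd K (A + B) = blkd K A + blkd K B := rfl
lemma blkd_smul (c : K) (A : gl K m 1) : blkd K (c • A) = c * blkd K A := rfl

/-- An antisymmetrised expression `Φ A B - Φ B A`, with `Φ` bilinear, vanishing on pairs of odd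
matrices is super-skew-symmetric. -/
lemma super_skew_of_antisymm {g : gl K m 1 → gl K m 1 → Wam K m} (h : ∀ A B, g B A = -g A B)
    (hodd : ∀ A B, IsHom K 1 A → IsHom K 1 B → g A B = 0) (pA pB : ZMod 2) (A B : gl K m 1)
    (hA : IsHom K pA A) (hB : IsHom K pB B) : g B A = -(sg K (pA * pB) • g A B) := by
  by_cases hp : pA * pB = 0
  · rw [hp, h A B]
    simp [sg]
  · obtain ⟨rfl, rfl⟩ : pA = 1 ∧ pB = 1 :=
      (by decide : ∀ p q : ZMod 2, p * q ≠ 0 → p = 1 ∧ q = 1) pA pB hp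
    rw [hodd A B hA hB, hodd B A hB hA, smul_zero, neg_zero]

/-- `g₁` as a bilinear map. -/
def g1Lin (hm : 0 < m) : gl K m 1 →ₗ[K] gl K m 1 →ₗ[K] Wam K m :=
  LinearMap.mk₂ K (g1 K m hm)
    (fun A A' B => by
      simp only [g1_eq, ← map_add, blka_add, rowy_add, Matrix.add_vecMul, Matrix.vecMul_add]
      congr 1; abel)
    (fun c A B => by
      simp only [g1_eq, ← map_smul, blka_smul, rowy_smul, Matrix.smul_vecMul, Matrix.vecMul_smul,
        smul_sub])
    (fun A B B' => by
      simp only [g1_eq, ← map_add, blka_add, rowy_add, Matrix.add_vecMul, Matrix.vecMul_add]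
      congr 1; abel)
    (fun c A B => by
      simp only [g1_eq, ← map_smul, blka_smul, rowy_smul, Matrix.smul_vecMul, Matrix.vecMul_smul,
        smul_sub])

/-- `g₂` as a bilinear map. -/
def g2Lin (hm : 0 < m) : gl K m 1 →ₗ[K] gl K m 1 →ₗ[K] Wam K m :=
  LinearMap.mk₂ K (g2 K m hm)
    (fun A A' B => by
      simp only [g2_eq, ← map_add, blka_add, rowy_add, Matrix.trace_add]
      congr 1; module)
    (fun c A B => by
      simp only [g2_eq, ← map_smul, blka_smul, rowy_smul, Matrix.trace_smul, smul_eq_mul]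
      congr 1; module)
    (fun A B B' => by
      simp only [g2_eq, ← map_add, blka_add, rowy_add, Matrix.trace_add]
      congr 1; module)
    (fun c A B => by
      simp only [g2_eq, ← map_smul, blka_smul, rowy_smul, Matrix.trace_smul, smul_eq_mul]
      congr 1; module)

/-- `g₃` as a bilinear map. -/
def g3Lin (hm : 0 < m) : gl K m 1 →ₗ[K] gl K m 1 →ₗ[K] Wam K m :=
  LinearMap.mk₂ K (g3 K m hm)
    (fun A A' B => by
      simp only [g3_eq, ← map_add, blkd_add, rowy_add]
      congr 1; module)
    (fun c A B => by
      simp only [g3_eq, ← map_smul, blkd_smul, rowy_smul]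
      congr 1; module)
    (fun A B B' => by
      simp only [g3_eq, ← map_add, blkd_add, rowy_add]
      congr 1; module)
    (fun c A B => by
      simp only [g3_eq, ← map_smul, blkd_smul, rowy_smul]
      congr 1; module)

lemma g1Lin_apply (hm : 0 < m) (A B : gl K m 1) : g1Lin hm A B = g1 K m hm A B := rfl

lemma g2Lin_apply (hm : 0 < m) (A B : gl K m 1) : g2Lin hm A B = g2 K m hm A B := rfl

lemma g3Lin_apply (hm : 0 < m) (A B : gl K m 1) : g3Lin hm A B = g3 K m hm A B := rfl

lemma g1Lin_mem (hm : 0 < m) : g1Lin hm ∈ invSkewMaps K m := by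
  refine ⟨fun A B => ?_, super_skew_of_antisymm (fun A B => ?_) (fun A B hA hB => ?_),
    fun C hC A B => ?_⟩
  · rw [g1Lin_apply, g1_eq]
    exact etaComb_mem hm _
  · simp only [g1Lin_apply, g1_eq, ← map_neg, neg_sub]
  · simp [g1Lin_apply, g1_eq, hA.blka_eq_zero, hB.blka_eq_zero]
  · simp only [g1Lin_apply, g1_eq, rho_etaComb hm hC, ← map_add]
    simp only [blka_sbr hC, rowy_sbr hC, Matrix.vecMul_sub, Matrix.sub_vecMul, Matrix.smul_vecMul,
      ← Matrix.vecMul_vecMul, smul_sub]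
    congr 1
    abel

lemma g2Lin_mem (hm : 0 < m) : g2Lin hm ∈ invSkewMaps K m := by
  refine ⟨fun A B => ?_, super_skew_of_antisymm (fun A B => ?_) (fun A B hA hB => ?_),
    fun C hC A B => ?_⟩
  · rw [g2Lin_apply, g2_eq]
    exact etaComb_mem hm _
  · simp only [g2Lin_apply, g2_eq, ← map_neg, neg_sub]
  · simp [g2Lin_apply, g2_eq, hA.blka_eq_zero, hB.blka_eq_zero]
  · simp only [g2Lin_apply, g2_eq, rho_etaComb hm hC, ← map_add]
    simp only [blka_sbr hC, rowy_sbr hC, Matrix.sub_vecMul, Matrix.smul_vecMul, Matrix.trace_sub,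
      Matrix.trace_mul_comm (blka K C), sub_self]
    congr 1
    module

lemma g3Lin_mem (hm : 0 < m) : g3Lin hm ∈ invSkewMaps K m := by
  refine ⟨fun A B => ?_, super_skew_of_antisymm (fun A B => ?_) (fun A B hA hB => ?_),
    fun C hC A B => ?_⟩
  · rw [g3Lin_apply, g3_eq]
    exact etaComb_mem hm _
  · simp only [g3Lin_apply, g3_eq, ← map_neg, neg_sub]
  · simp [g3Lin_apply, g3_eq, hA.blkd_eq_zero, hB.blkd_eq_zero]
  · simp only [g3Lin_apply, g3_eq, rho_etaComb hm hC, ← map_add]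
    simp only [blkd_sbr hC, rowy_sbr hC, Matrix.sub_vecMul, Matrix.smul_vecMul]
    congr 1
    module

end StandardMaps

section Weights

variable {K} {m : ℕ}

variable (K) in
/-- The weight of the matrix unit `E_{ab}` with respect to `E_{ll}`. -/
def wt (l a b : Fin (m + 1)) : K := (if a = l then 1 else 0) - if b = l then 1 else 0

lemma wt_eq (l a b : Fin (m + 1)) :
    wt K l a b = (Pi.single l 1 : Fin (m + 1) → K) a - (Pi.single l 1 : Fin (m + 1) → K) b := by
  simp [wt, Pi.single_apply]

lemma isHom_single (a b : Fin (m + 1)) :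
    IsHom K (par m 1 a + par m 1 b) (Matrix.single a b 1 : gl K m 1) := by
  intro i j h
  obtain ⟨rfl, rfl⟩ : a = i ∧ b = j := by
    by_contra h'
    exact h (Matrix.single_apply_of_ne _ _ _ _ _ h')
  rfl

lemma isHom_single_castSucc (p q : Fin m) :
    IsHom K 0 (Matrix.single (Fin.castSucc p) (Fin.castSucc q) 1 : gl K m 1) := by
  have := isHom_single (K := K) (Fin.castSucc p) (Fin.castSucc q)
  rwa [par_castSucc, par_castSucc, add_zero] at this

lemma isHom_diagonal (t : Fin (m + 1) → K) : IsHom K 0 (Matrix.diagonal t : gl K m 1) := by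
  intro i j h
  obtain rfl : i = j := by
    by_contra h'
    exact h (Matrix.diagonal_apply_ne _ h')
  exact CharTwo.add_self_eq_zero _

lemma sbr_diagonal_single (t : Fin (m + 1) → K) (a b : Fin (m + 1)) :
    sbr K (Matrix.diagonal t : gl K m 1) (Matrix.single a b 1) =
      (t a - t b) • (Matrix.single a b 1 : gl K m 1) := by
  rw [sbr_of_even (isHom_diagonal t)]
  ext i j
  simp only [Matrix.sub_apply, Matrix.diagonal_mul, Matrix.mul_diagonal, Matrix.smul_apply,
    Matrix.single_apply, smul_eq_mul]
  split_ifs with h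
  · rw [h.1, h.2]; ring
  · ring

lemma sbr_single_single (p q : Fin m) (a b : Fin (m + 1)) :
    sbr K (Matrix.single (Fin.castSucc p) (Fin.castSucc q) 1 : gl K m 1) (Matrix.single a b 1) =
      (if Fin.castSucc q = a then Matrix.single (Fin.castSucc p) b 1 else 0) -
        (if b = Fin.castSucc p then Matrix.single a (Fin.castSucc q) 1 else 0) := by
  rw [sbr_of_even (isHom_single_castSucc p q)]
  congr 1
  · split_ifs with h
    · subst h; simp
    · exact Matrix.single_mul_single_of_ne _ _ _ _ h _
  · split_ifs with h
    · subst h; simp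
    · exact Matrix.single_mul_single_of_ne _ _ _ _ h _

variable {f : gl K m 1 →ₗ[K] gl K m 1 →ₗ[K] Wam K m}

lemma rho_diagonal_apply (hf : f ∈ invSkewMaps K m) (t : Fin (m + 1) → K)
    (a b c d : Fin (m + 1)) :
    rho K (Matrix.diagonal t) (f (Matrix.single a b 1) (Matrix.single c d 1)) =
      (t a - t b + (t c - t d)) • f (Matrix.single a b 1) (Matrix.single c d 1) := by
  rw [hf.2.2 _ (isHom_diagonal t), sbr_diagonal_single, sbr_diagonal_single, map_smul, map_smul,
    LinearMap.smul_apply, add_smul]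

lemma apply_single_slot_eq_zero (hf : f ∈ invSkewMaps K m) (a b c d : Fin (m + 1)) (r : Fin m)
    (h : wt K (Fin.last m) a b + wt K (Fin.last m) c d ≠ ((r : ℕ) + 1 : ℕ)) :
    f (Matrix.single a b 1) (Matrix.single c d 1) r = 0 := by
  have h1 := congrFun (rho_diagonal_apply hf (Pi.single (Fin.last m) 1) a b c d) r
  rw [← wt_eq, ← wt_eq] at h1
  have h2 : blka K (Matrix.diagonal (Pi.single (Fin.last m) 1) : gl K m 1) = 0 := by
    ext i j
    simp [blka, Matrix.diagonal_apply]
  have h3 : blkd K (Matrix.diagonal (Pi.single (Fin.last m) 1) : gl K m 1) = 1 := by simp [blkd]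
  rw [rho_of_even (isHom_diagonal _), h2, h3, mul_one, Pi.smul_apply] at h1
  simp only [theta, Matrix.zero_apply, zero_smul, Finset.sum_const_zero, LinearMap.zero_apply,
    Matrix.trace_zero, sub_zero, zero_add] at h1
  exact (smul_eq_zero.1 (show (_ - _ : K) • f (Matrix.single a b 1) (Matrix.single c d 1) r = 0 by
    rw [sub_smul, ← h1, sub_self])).resolve_left (sub_ne_zero.2 h)

lemma theta_apply_single (hf : f ∈ invSkewMaps K m) (i : Fin m) (a b c d : Fin (m + 1))
    (r : Fin m) :
    theta K (Matrix.single i i 1) (f (Matrix.single a b 1) (Matrix.single c d 1) r) =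
      (1 + (wt K (Fin.castSucc i) a b + wt K (Fin.castSucc i) c d)) •
        f (Matrix.single a b 1) (Matrix.single c d 1) r := by
  have h1 := congrFun (rho_diagonal_apply hf (Pi.single (Fin.castSucc i) 1) a b c d) r
  rw [← wt_eq, ← wt_eq] at h1
  have h2 : blka K (Matrix.diagonal (Pi.single (Fin.castSucc i) 1) : gl K m 1) =
      Matrix.single i i 1 := by
    rw [← Matrix.diagonal_single]
    ext j l
    simp [blka, Matrix.diagonal_apply, Pi.single_apply]
  have h3 : blkd K (Matrix.diagonal (Pi.single (Fin.castSucc i) 1) : gl K m 1) = 0 := by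
    simp [blkd]
  rw [rho_of_even (isHom_diagonal _), h2, h3, mul_zero, zero_smul, add_zero, Pi.smul_apply,
    Matrix.trace_single_eq_same, one_smul, sub_eq_iff_eq_add'] at h1
  rw [h1, add_smul (1 : K), one_smul]

lemma apply_single_eq_zero_of_weight (hf : f ∈ invSkewMaps K m) (i : Fin m)
    (a b c d : Fin (m + 1))
    (h0 : wt K (Fin.castSucc i) a b + wt K (Fin.castSucc i) c d ≠ 0)
    (h1 : 1 + (wt K (Fin.castSucc i) a b + wt K (Fin.castSucc i) c d) ≠ 0) :
    f (Matrix.single a b 1) (Matrix.single c d 1) = 0 := by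
  funext r
  have h := theta_apply_single hf i a b c d r
  have h2 := theta_single_idem i (f (Matrix.single a b 1) (Matrix.single c d 1) r)
  rw [h, map_smul, h] at h2
  have h3 := smul_right_injective _ h1 h2
  rw [add_smul (1 : K), one_smul, add_eq_left] at h3
  exact (smul_eq_zero.1 h3).resolve_left h0

lemma exists_apply_single_eq [CharZero K] (hf : f ∈ invSkewMaps K m) (hm : 0 < m) (k : Fin m)
    (a b c d : Fin (m + 1))
    (hlast : wt K (Fin.last m) a b + wt K (Fin.last m) c d = 1)
    (h : ∀ i, i ≠ k → wt K (Fin.castSucc i) a b + wt K (Fin.castSucc i) c d = 0) :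
    ∃ s : K, f (Matrix.single a b 1) (Matrix.single c d 1) =
      s • etaComb hm (Pi.single k (1 : K)) := by
  have hmem := hf.1 (Matrix.single a b 1) (Matrix.single c d 1) ⟨0, hm⟩ (Set.mem_univ _)
  obtain ⟨s, hs⟩ := exists_smul_eta hm k hmem fun i hi => by
    rw [theta_apply_single hf, h i hi, add_zero, one_smul]
  refine ⟨s, funext fun r => ?_⟩
  rw [etaComb_single, one_smul, Pi.smul_apply]
  rcases eq_or_ne r ⟨0, hm⟩ with rfl | hr
  · rw [hs, Pi.single_eq_same]
  · rw [Pi.single_eq_of_ne hr, smul_zero]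
    refine apply_single_slot_eq_zero hf a b c d r ?_
    rw [hlast]
    have : (r : ℕ) ≠ 0 := fun h => hr (Fin.ext h)
    exact_mod_cast fun h => this (by omega)

lemma rho_single_etaComb (hm : 0 < m) {p q : Fin m} (hpq : p ≠ q) (k : Fin m) :
    rho K (Matrix.single (Fin.castSucc p) (Fin.castSucc q) 1 : gl K m 1)
      (etaComb hm (Pi.single k (1 : K))) =
      -if k = p then etaComb hm (Pi.single q (1 : K)) else 0 := by
  have h1 : blka K (Matrix.single (Fin.castSucc p) (Fin.castSucc q) 1 : gl K m 1) =
      Matrix.single p q 1 := by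
    ext i j
    simp [blka, Matrix.single_apply]
  have h2 : blkd K (Matrix.single (Fin.castSucc p) (Fin.castSucc q) 1 : gl K m 1) = 0 := by
    simp [blkd]
  rw [rho_etaComb hm (isHom_single_castSucc p q), h1, h2, zero_smul, zero_sub, map_neg]
  congr 1
  split_ifs with h
  · subst h
    congr 1
    ext j
    simp [Matrix.single_apply, Pi.single_apply, eq_comm]
  · rw [← map_zero (etaComb hm)]
    congr 1
    ext j
    simp [Matrix.single_apply_of_row_ne (Ne.symm h)]

/-- Invariance of `f` under the unit `E_{pq}`, evaluated at `(E_{ij}, E_{m+1,k})`. -/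
lemma rho_single_apply_single (hf : f ∈ invSkewMaps K m) (p q i j k : Fin m) :
    rho K (Matrix.single (Fin.castSucc p) (Fin.castSucc q) 1)
      (f (Matrix.single (Fin.castSucc i) (Fin.castSucc j) 1)
        (Matrix.single (Fin.last m) (Fin.castSucc k) 1)) =
      (if q = i then f (Matrix.single (Fin.castSucc p) (Fin.castSucc j) 1)
        (Matrix.single (Fin.last m) (Fin.castSucc k) 1) else 0) -
      (if j = p then f (Matrix.single (Fin.castSucc i) (Fin.castSucc q) 1)
        (Matrix.single (Fin.last m) (Fin.castSucc k) 1) else 0) -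
      (if k = p then f (Matrix.single (Fin.castSucc i) (Fin.castSucc j) 1)
        (Matrix.single (Fin.last m) (Fin.castSucc q) 1) else 0) := by
  rw [hf.2.2 _ (isHom_single_castSucc p q), sbr_single_single, sbr_single_single]
  simp only [Fin.castSucc_inj, (Fin.castSucc_ne_last _), if_false, zero_sub, map_sub, map_neg,
    LinearMap.sub_apply, ← sub_eq_add_neg]
  split_ifs <;> simp

lemma apply_rows_eq_zero [CharZero K] (hf : f ∈ invSkewMaps K m) (k l : Fin m) :
    f (Matrix.single (Fin.last m) (Fin.castSucc k) 1)
      (Matrix.single (Fin.last m) (Fin.castSucc l) 1) = 0 := by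
  have hdiag (k : Fin m) : f (Matrix.single (Fin.last m) (Fin.castSucc k) 1)
      (Matrix.single (Fin.last m) (Fin.castSucc k) 1) = 0 := by
    refine apply_single_eq_zero_of_weight hf k _ _ _ _ ?_ ?_ <;>
    simp [wt, (Fin.castSucc_ne_last _).symm]
  rcases eq_or_ne k l with rfl | hkl
  · exact hdiag k
  · have h1 := hf.2.2 _ (isHom_single_castSucc k l)
      (Matrix.single (Fin.last m) (Fin.castSucc k) 1)
      (Matrix.single (Fin.last m) (Fin.castSucc k) 1)
    have hodd (k : Fin m) :
        IsHom K 1 (Matrix.single (Fin.last m) (Fin.castSucc k) 1 : gl K m 1) := by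
      have := isHom_single (K := K) (Fin.last m) (Fin.castSucc k)
      rwa [par_castSucc, par_last, add_zero] at this
    have h2 := hf.2.1 1 1 _ _ (hodd k) (hodd l)
    simp only [sbr_single_single, hdiag, map_zero, Fin.castSucc_ne_last, if_false, if_true,
      zero_sub, map_neg, LinearMap.neg_apply, h2, sg, mul_one, one_ne_zero, neg_smul, one_smul,
      neg_neg] at h1
    have h3 : (2 : K) • f (Matrix.single (Fin.last m) (Fin.castSucc k) 1)
      (Matrix.single (Fin.last m) (Fin.castSucc l) 1) = 0 := by
      rw [two_smul, ← neg_eq_zero, neg_add, ← h1]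
    exact (smul_eq_zero.1 h3).resolve_left two_ne_zero

lemma apply_last_row_eq_zero (hf : f ∈ invSkewMaps K m) {i₀ : Fin m}
    (hs : f (Matrix.single (Fin.last m) (Fin.last m) 1)
      (Matrix.single (Fin.last m) (Fin.castSucc i₀) 1) = 0) (k : Fin m) :
    f (Matrix.single (Fin.last m) (Fin.last m) 1)
      (Matrix.single (Fin.last m) (Fin.castSucc k) 1) = 0 := by
  rcases eq_or_ne i₀ k with rfl | h
  · exact hs
  · have := hf.2.2 _ (isHom_single_castSucc i₀ k) (Matrix.single (Fin.last m) (Fin.last m) 1)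
      (Matrix.single (Fin.last m) (Fin.castSucc i₀) 1)
    simpa [hs, sbr_single_single, (Fin.castSucc_ne_last _).symm, Fin.castSucc_ne_last] using this

end Weights

section Classification

variable {K} [CharZero K] {m : ℕ} {f : gl K m 1 →ₗ[K] gl K m 1 →ₗ[K] Wam K m}

lemma apply_single_eq_zero_of_last_weight (hf : f ∈ invSkewMaps K m) (z : ℕ)
    (a b c d : Fin (m + 1))
    (h : wt K (Fin.last m) a b + wt K (Fin.last m) c d = -z) :
    f (Matrix.single a b 1) (Matrix.single c d 1) = 0 := by
  funext r
  refine apply_single_slot_eq_zero hf a b c d r ?_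
  rw [h, Ne, neg_eq_iff_add_eq_zero]
  exact_mod_cast (by omega : z + ((r : ℕ) + 1) ≠ 0)

lemma apply_single_row_eq_zero (hf : f ∈ invSkewMaps K m) (hm : 0 < m) {i₀ i₁ : Fin m}
    (h01 : i₀ ≠ i₁)
    (hc : f (Matrix.single (Fin.castSucc i₀) (Fin.castSucc i₀) 1)
      (Matrix.single (Fin.last m) (Fin.castSucc i₁) 1) = 0)
    (hd : f (Matrix.single (Fin.castSucc i₀) (Fin.castSucc i₁) 1)
      (Matrix.single (Fin.last m) (Fin.castSucc i₀) 1) = 0) (i j k : Fin m) :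
    f (Matrix.single (Fin.castSucc i) (Fin.castSucc j) 1)
      (Matrix.single (Fin.last m) (Fin.castSucc k) 1) = 0 := by
  set e : Fin m → Wam K m := fun k => etaComb hm (Pi.single k (1 : K)) with he
  have inj (q : Fin m) {s t : K} (h : s • e q = t • e q) : s = t :=
    smul_left_injective K (etaComb_single_ne_zero hm q) h
  have hC (i k : Fin m) : ∃ s : K, f (Matrix.single (Fin.castSucc i) (Fin.castSucc i) 1)
      (Matrix.single (Fin.last m) (Fin.castSucc k) 1) = s • e k := by
    refine exists_apply_single_eq hf hm k _ _ _ _ ?_ fun l hl => ?_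
    · simp [wt]
    · simp [wt, hl.symm, (Fin.castSucc_ne_last _).symm]
  have hD (k j : Fin m) : ∃ s : K, f (Matrix.single (Fin.castSucc k) (Fin.castSucc j) 1)
      (Matrix.single (Fin.last m) (Fin.castSucc k) 1) = s • e j := by
    refine exists_apply_single_eq hf hm j _ _ _ _ ?_ fun l hl => ?_
    · simp [wt]
    · simp [wt, hl.symm, (Fin.castSucc_ne_last _).symm]
  have hO (i j k : Fin m) (hij : i ≠ j) (hik : i ≠ k) :
      f (Matrix.single (Fin.castSucc i) (Fin.castSucc j) 1)
      (Matrix.single (Fin.last m) (Fin.castSucc k) 1) = 0 := by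
    refine apply_single_eq_zero_of_weight hf i _ _ _ _ ?_ ?_ <;>
    simp [wt, hij.symm, hik.symm, (Fin.castSucc_ne_last _).symm]
  choose c hc' using hC
  choose d hd' using hD
  have hrho (p q k : Fin m) (hpq : p ≠ q) :
      rho K (Matrix.single (Fin.castSucc p) (Fin.castSucc q) 1 : gl K m 1) (e k) =
        -if k = p then e q else 0 := rho_single_etaComb hm hpq k
  have r1 (i k : Fin m) (h : k ≠ i) : c i i = d k i + c i k := by
    have := rho_single_apply_single hf k i i i k
    rw [hc', map_smul, hrho _ _ _ h] at this
    simp only [if_true, if_neg h.symm, hc', hd', sub_zero] at this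
    apply inj i
    linear_combination (norm := module) this
  have r2 (i q : Fin m) (h : i ≠ q) : c i i = d i q + c i q := by
    have := rho_single_apply_single hf i q i i i
    rw [hc', map_smul, hrho _ _ _ h] at this
    simp only [if_true, if_neg h.symm, hc', hd'] at this
    apply inj q
    linear_combination (norm := module) -this
  have r3 (k j : Fin m) (h : j ≠ k) : c k k = c j k + d k j := by
    have := rho_single_apply_single hf j k k j k
    rw [hd', map_smul, hrho _ _ _ h] at this
    simp only [if_true, if_neg h.symm, hc'] at this
    apply inj k
    linear_combination (norm := module) this
  have r4 (k j q : Fin m) (hj : k ≠ j) (hq : k ≠ q) : d k j = d k q := by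
    rcases eq_or_ne j q with rfl | hjq
    · rfl
    have := rho_single_apply_single hf j q k j k
    rw [hd', map_smul, hrho _ _ _ hjq] at this
    simp only [if_true, if_neg hq.symm, if_neg hj, hd'] at this
    apply inj q
    linear_combination (norm := module) -this
  have d01 : d i₀ i₁ = 0 := inj i₁ (by rw [← hd', hd, zero_smul])
  have c01 : c i₀ i₁ = 0 := inj i₁ (by rw [← hc', hc, zero_smul])
  have dswap (k j : Fin m) (h : k ≠ j) : d k j = d j k := by
    linear_combination r1 k j h.symm - r2 k j h
  have d0 (k j : Fin m) (h : k ≠ j) : d k j = 0 := by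
    have h0 (j : Fin m) (h : i₀ ≠ j) : d i₀ j = 0 := (r4 _ _ _ h h01).trans d01
    rcases eq_or_ne k i₀ with rfl | hk
    · exact h0 j h
    · rw [r4 k j i₀ h hk, dswap _ _ hk, h0 k hk.symm]
  have c0 (i k : Fin m) : c i k = 0 := by
    have h0 (i : Fin m) : c i i = 0 := by
      have h00 : c i₀ i₀ = 0 := by rw [r2 _ _ h01, d01, c01, add_zero]
      rcases eq_or_ne i i₀ with rfl | hi
      · exact h00
      · linear_combination r3 i i₀ hi.symm - r1 i₀ i hi + h00
    rcases eq_or_ne i k with rfl | h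
    · exact h0 i
    · linear_combination h0 i - r2 i k h - d0 i k h
  rcases eq_or_ne i j with rfl | hij
  · rw [hc', c0, zero_smul]
  · rcases eq_or_ne i k with rfl | hik
    · rw [hd', d0 _ _ hij, zero_smul]
    · exact hO i j k hij hik

lemma eq_zero_of_mem_invSkewMaps (hf : f ∈ invSkewMaps K m) (hm : 0 < m) {i₀ i₁ : Fin m}
    (h01 : i₀ ≠ i₁)
    (hc : f (Matrix.single (Fin.castSucc i₀) (Fin.castSucc i₀) 1)
      (Matrix.single (Fin.last m) (Fin.castSucc i₁) 1) = 0)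
    (hd : f (Matrix.single (Fin.castSucc i₀) (Fin.castSucc i₁) 1)
      (Matrix.single (Fin.last m) (Fin.castSucc i₀) 1) = 0)
    (hs : f (Matrix.single (Fin.last m) (Fin.last m) 1)
      (Matrix.single (Fin.last m) (Fin.castSucc i₀) 1) = 0) : f = 0 := by
  have hrow := apply_single_row_eq_zero hf hm h01 hc hd
  have hlast := apply_last_row_eq_zero hf hs
  have hswap {a b c d : Fin (m + 1)} (hab : par m 1 a + par m 1 b = 0)
      (h : f (Matrix.single a b 1) (Matrix.single c d 1) = 0) :
      f (Matrix.single c d 1) (Matrix.single a b 1) = 0 := by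
    rw [hf.2.1 _ _ _ _ (isHom_single a b) (isHom_single c d), h, smul_zero, neg_zero]
  suffices h : ∀ a b c d : Fin (m + 1),
      f (Matrix.single a b 1) (Matrix.single c d 1) = 0 by
    exact Matrix.ext_linearMap K fun a b => LinearMap.ext_ring <|
      Matrix.ext_linearMap K fun c d => LinearMap.ext_ring (h a b c d)
  intro a b c d
  induction a using Fin.lastCases <;> induction b using Fin.lastCases <;>
    induction c using Fin.lastCases <;> induction d using Fin.lastCases
  case last.last.last.cast k => exact hlast k
  case cast.cast.last.cast i j k => exact hrow i j k
  case last.cast.last.last k => exact hswap (CharTwo.add_self_eq_zero _) (hlast k)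
  case last.cast.cast.cast k i j =>
    exact hswap (by rw [par_castSucc, par_castSucc, add_zero]) (hrow i j k)
  case last.cast.last.cast k l => exact apply_rows_eq_zero hf k l
  case cast.last.cast.last =>
    exact apply_single_eq_zero_of_last_weight hf 2 _ _ _ _ (by simp [wt]; norm_num)
  all_goals first
    | (refine apply_single_eq_zero_of_last_weight hf 0 _ _ _ _ ?_; simp [wt]; done)
    | (refine apply_single_eq_zero_of_last_weight hf 1 _ _ _ _ ?_; simp [wt])

end Classification

section UnitValues

variable {K} {m : ℕ}

lemma blka_single_castSucc (i j : Fin m) :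
    blka K (Matrix.single (Fin.castSucc i) (Fin.castSucc j) 1 : gl K m 1) =
      Matrix.single i j 1 := by
  ext p q
  simp [blka, Matrix.single_apply]

lemma rowy_single_castSucc (i : Fin m) (b : Fin (m + 1)) :
    rowy (Matrix.single (Fin.castSucc i) b 1 : gl K m 1) = 0 := by
  ext p
  simp [rowy]

lemma blkd_single_castSucc (a : Fin (m + 1)) (i : Fin m) :
    blkd K (Matrix.single a (Fin.castSucc i) 1 : gl K m 1) = 0 := by
  simp [blkd]

lemma blka_single_last (b : Fin (m + 1)) :
    blka K (Matrix.single (Fin.last m) b 1 : gl K m 1) = 0 := by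
  ext p q
  simp [blka, (Fin.castSucc_ne_last _).symm]

lemma rowy_single_last_castSucc (k : Fin m) :
    rowy (Matrix.single (Fin.last m) (Fin.castSucc k) 1 : gl K m 1) = Pi.single k 1 := by
  ext p
  simp [rowy, Matrix.single_apply, Pi.single_apply, eq_comm]

lemma rowy_single_last_last :
    rowy (Matrix.single (Fin.last m) (Fin.last m) 1 : gl K m 1) = 0 := by
  ext p
  simp [rowy, (Fin.castSucc_ne_last _).symm]

lemma g1_single_castSucc (hm : 0 < m) (i j k : Fin m) :
    g1 K m hm (Matrix.single (Fin.castSucc i) (Fin.castSucc j) 1)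
      (Matrix.single (Fin.last m) (Fin.castSucc k) 1) =
      if i = k then etaComb hm (Pi.single j 1) else 0 := by
  rw [g1_eq, blka_single_castSucc, blka_single_last, rowy_single_castSucc,
    rowy_single_last_castSucc, Matrix.zero_vecMul, sub_zero, Matrix.single_one_vecMul]
  split_ifs with h
  · subst h
    congr 1
    ext p
    simp [Matrix.single_apply, Pi.single_apply, eq_comm]
  · rw [← map_zero (etaComb hm)]
    congr 1
    ext p
    simp [Matrix.single_apply_of_row_ne h]

lemma g2_single_castSucc (hm : 0 < m) (i j k : Fin m) :
    g2 K m hm (Matrix.single (Fin.castSucc i) (Fin.castSucc j) 1)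
      (Matrix.single (Fin.last m) (Fin.castSucc k) 1) =
      if i = j then etaComb hm (Pi.single k 1) else 0 := by
  rw [g2_eq, blka_single_castSucc, rowy_single_castSucc, rowy_single_last_castSucc, smul_zero,
    sub_zero]
  split_ifs with h
  · rw [h, Matrix.trace_single_eq_same, one_smul]
  · rw [Matrix.trace_single_eq_of_ne _ _ _ h, zero_smul, map_zero]

lemma g3_single_castSucc (hm : 0 < m) (i j k : Fin m) :
    g3 K m hm (Matrix.single (Fin.castSucc i) (Fin.castSucc j) 1)
      (Matrix.single (Fin.last m) (Fin.castSucc k) 1) = 0 := by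
  rw [g3_eq, blkd_single_castSucc, blkd_single_castSucc, zero_smul, zero_smul, sub_zero, map_zero]

lemma g1_single_last (hm : 0 < m) (k : Fin m) :
    g1 K m hm (Matrix.single (Fin.last m) (Fin.last m) 1)
      (Matrix.single (Fin.last m) (Fin.castSucc k) 1) = 0 := by
  rw [g1_eq, blka_single_last, blka_single_last, Matrix.vecMul_zero, Matrix.vecMul_zero, sub_zero,
    map_zero]

lemma g2_single_last (hm : 0 < m) (k : Fin m) :
    g2 K m hm (Matrix.single (Fin.last m) (Fin.last m) 1)
      (Matrix.single (Fin.last m) (Fin.castSucc k) 1) = 0 := by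
  rw [g2_eq, blka_single_last, blka_single_last, Matrix.trace_zero, zero_smul, zero_smul, sub_zero,
    map_zero]

lemma g3_single_last (hm : 0 < m) (k : Fin m) :
    g3 K m hm (Matrix.single (Fin.last m) (Fin.last m) 1)
      (Matrix.single (Fin.last m) (Fin.castSucc k) 1) = etaComb hm (Pi.single k 1) := by
  rw [g3_eq, rowy_single_last_last, rowy_single_last_castSucc, smul_zero, sub_zero,
    show blkd K (Matrix.single (Fin.last m) (Fin.last m) 1 : gl K m 1) = 1 by simp [blkd], one_smul]

end UnitValues

/-- Let `m ≥ 2` and `G = gl(m|1)` acting on `V` via `ρ`.  The maps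
`g₁, g₂, g₃` form a basis of the space of super-skew-symmetric `G₀`-invariant bilinear
maps `G × G → V`. -/
theorem g1_g2_g3_basis_of_invariant_skew_maps
    (K : Type) [Field K] [IsAlgClosed K] [CharZero K] (m : ℕ) (hm : 2 ≤ m) :
    -- `g₁, g₂, g₃` are bilinear ...
    (∃ G1 G2 G3 : gl K m 1 →ₗ[K] gl K m 1 →ₗ[K] Wam K m, ∀ A B : gl K m 1,
      G1 A B = g1 K m (by omega) A B ∧ G2 A B = g2 K m (by omega) A B ∧
      G3 A B = g3 K m (by omega) A B) ∧
    -- ... take values in `V` ...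
    (∀ A B : gl K m 1, g1 K m (by omega) A B ∈ Vsub K m ∧ g2 K m (by omega) A B ∈ Vsub K m ∧
      g3 K m (by omega) A B ∈ Vsub K m) ∧
    -- ... are super-skew-symmetric ...
    (∀ (pA pB : ZMod 2) (A B : gl K m 1), IsHom K pA A → IsHom K pB B →
      g1 K m (by omega) B A = -(sg K (pA * pB) • g1 K m (by omega) A B) ∧
      g2 K m (by omega) B A = -(sg K (pA * pB) • g2 K m (by omega) A B) ∧
      g3 K m (by omega) B A = -(sg K (pA * pB) • g3 K m (by omega) A B)) ∧
    -- ... and `G₀`-invariant ...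
    (∀ C : gl K m 1, IsHom K 0 C → ∀ A B : gl K m 1,
      rho K C (g1 K m (by omega) A B)
        = g1 K m (by omega) (sbr K C A) B + g1 K m (by omega) A (sbr K C B) ∧
      rho K C (g2 K m (by omega) A B)
        = g2 K m (by omega) (sbr K C A) B + g2 K m (by omega) A (sbr K C B) ∧
      rho K C (g3 K m (by omega) A B)
        = g3 K m (by omega) (sbr K C A) B + g3 K m (by omega) A (sbr K C B)) ∧
    -- ... they are linearly independent ...
    (∀ c1 c2 c3 : K,
      (∀ A B : gl K m 1,
        c1 • g1 K m (by omega) A B + c2 • g2 K m (by omega) A B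
          + c3 • g3 K m (by omega) A B = 0) →
      c1 = 0 ∧ c2 = 0 ∧ c3 = 0) ∧
    -- ... and they span the space of super-skew-symmetric `G₀`-invariant bilinear maps
    -- `G × G → V`.
    (∀ f : gl K m 1 →ₗ[K] gl K m 1 →ₗ[K] Wam K m,
      (∀ A B : gl K m 1, f A B ∈ Vsub K m) →
      (∀ (pA pB : ZMod 2) (A B : gl K m 1), IsHom K pA A → IsHom K pB B →
        f B A = -(sg K (pA * pB) • f A B)) →
      (∀ C : gl K m 1, IsHom K 0 C → ∀ A B : gl K m 1,
        rho K C (f A B) = f (sbr K C A) B + f A (sbr K C B)) →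
      ∃ c1 c2 c3 : K, ∀ A B : gl K m 1,
        f A B = c1 • g1 K m (by omega) A B + c2 • g2 K m (by omega) A B
          + c3 • g3 K m (by omega) A B) := by
  have hm0 : 0 < m := by omega
  obtain ⟨i₀, i₁, h01⟩ : ∃ i₀ i₁ : Fin m, i₀ ≠ i₁ :=
    ⟨⟨0, hm0⟩, ⟨1, hm⟩, by simp⟩
  have hne (i : Fin m) : Fin.last m ≠ Fin.castSucc i := (Fin.castSucc_ne_last i).symm
  have G1 := g1Lin_mem (K := K) hm0
  have G2 := g2Lin_mem (K := K) hm0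
  have G3 := g3Lin_mem (K := K) hm0
  refine ⟨⟨g1Lin hm0, g2Lin hm0, g3Lin hm0, fun A B => ⟨rfl, rfl, rfl⟩⟩,
    fun A B => ⟨G1.1 A B, G2.1 A B, G3.1 A B⟩,
    fun pA pB A B hA hB =>
      ⟨G1.2.1 pA pB A B hA hB, G2.2.1 pA pB A B hA hB, G3.2.1 pA pB A B hA hB⟩,
    fun C hC A B => ⟨G1.2.2 C hC A B, G2.2.2 C hC A B, G3.2.2 C hC A B⟩,
    fun c1 c2 c3 h => ⟨?_, ?_, ?_⟩, fun f hV hskew hinv => ?_⟩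
  · have := h (Matrix.single (Fin.castSucc i₀) (Fin.castSucc i₁) 1)
      (Matrix.single (Fin.last m) (Fin.castSucc i₀) 1)
    simpa [g1_single_castSucc, g2_single_castSucc, g3_single_castSucc, h01,
      etaComb_single_ne_zero] using this
  · have := h (Matrix.single (Fin.castSucc i₀) (Fin.castSucc i₀) 1)
      (Matrix.single (Fin.last m) (Fin.castSucc i₁) 1)
    simpa [g1_single_castSucc, g2_single_castSucc, g3_single_castSucc, h01,
      etaComb_single_ne_zero] using this
  · have := h (Matrix.single (Fin.last m) (Fin.last m) 1)
      (Matrix.single (Fin.last m) (Fin.castSucc i₀) 1)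
    simpa [g1_single_last, g2_single_last, g3_single_last, etaComb_single_ne_zero] using this
  · have hf : f ∈ invSkewMaps K m := ⟨hV, hskew, hinv⟩
    obtain ⟨c1, h1⟩ := exists_apply_single_eq hf hm0 i₁
      (Fin.castSucc i₀) (Fin.castSucc i₁) (Fin.last m) (Fin.castSucc i₀)
      (by simp [wt]) fun l hl => by simp [wt, hl.symm, hne]
    obtain ⟨c2, h2⟩ := exists_apply_single_eq hf hm0 i₁
      (Fin.castSucc i₀) (Fin.castSucc i₀) (Fin.last m) (Fin.castSucc i₁)
      (by simp [wt]) fun l hl => by simp [wt, hl.symm, hne]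
    obtain ⟨c3, h3⟩ := exists_apply_single_eq hf hm0 i₀
      (Fin.last m) (Fin.last m) (Fin.last m) (Fin.castSucc i₀)
      (by simp [wt]) fun l hl => by simp [wt, hl.symm, hne]
    refine ⟨c1, c2, c3, fun A B => ?_⟩
    have hmem : f + (-c1 • g1Lin hm0 + -c2 • g2Lin hm0 + -c3 • g3Lin hm0) ∈ invSkewMaps K m :=
      add_mem hf (add_mem (add_mem (Submodule.smul_mem _ _ G1) (Submodule.smul_mem _ _ G2))
        (Submodule.smul_mem _ _ G3))
    have hzero := eq_zero_of_mem_invSkewMaps hmem hm0 h01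
      (by simp [h2, g1Lin_apply, g2Lin_apply, g3Lin_apply, g1_single_castSucc,
        g2_single_castSucc, g3_single_castSucc, h01])
      (by simp [h1, g1Lin_apply, g2Lin_apply, g3Lin_apply, g1_single_castSucc,
        g2_single_castSucc, g3_single_castSucc, h01])
      (by simp [h3, g1Lin_apply, g2Lin_apply, g3Lin_apply, g1_single_last,
        g2_single_last, g3_single_last])
    have hAB : f A B + (-c1 • g1 K m hm0 A B + -c2 • g2 K m hm0 A B + -c3 • g3 K m hm0 A B) = 0 :=
      LinearMap.congr_fun (LinearMap.congr_fun hzero A) B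
    linear_combination (norm := module) hAB
end

section
/- Let L = sl(3|2). Every super-skew-symmetric bilinear map f : L×L → 𝕂 (f(B,A) = −(−1)^{|A||B|} f(A,B) for homogeneous A,B) satisfying the cyclic cocycle identity (−1)^{|A||C|} f(⟨A,B⟩,C) + (−1)^{|B||A|} f(⟨B,C⟩,A) + (−1)^{|C||B|} f(⟨C,A⟩,B) = 0 for all homogeneous A,B,C ∈ L is of the form f(A,B) = φ(⟨A,B⟩) for some linear map φ : L → 𝕂. Equivalently, H²(sl(3|2), 𝕂) = 0 for the trivial module 𝕂. -/
open Matrix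

variable (K : Type) [Field K]

section Supercocycle

variable {K} {m n : ℕ}

local notation "E[" i ", " j "]" => Matrix.single i j (1 : K)

theorem sg_zero : sg K 0 = 1 := by simp [sg]

theorem sg_add (p q : ZMod 2) : sg K (p + q) = sg K p * sg K q := by
  have h01 : ∀ p : ZMod 2, p = 0 ∨ p = 1 := by decide
  have h11 : (1 + 1 : ZMod 2) = 0 := by decide
  rcases h01 p with rfl | rfl <;> rcases h01 q with rfl | rfl <;> simp [sg, h11]

theorem sg_mul_self (p : ZMod 2) : sg K p * sg K p = 1 := by
  unfold sg; split_ifs <;> simp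

theorem zmod_two_add_self (p : ZMod 2) : p + p = 0 := by
  revert p; decide

theorem zmod_two_mul_self (p : ZMod 2) : p * p = p := by
  revert p; decide

/-- The super bracket as a bilinear map. -/
def sbrBilin (m n : ℕ) : gl K m n →ₗ[K] gl K m n →ₗ[K] gl K m n :=
  have evenP_add (A B : gl K m n) : evenP K (A + B) = evenP K A + evenP K B := by
    ext i j; simp only [evenP, Matrix.of_apply, Matrix.add_apply]; split_ifs <;> simp
  have oddP_add (A B : gl K m n) : oddP K (A + B) = oddP K A + oddP K B := by
    ext i j; simp only [oddP, Matrix.of_apply, Matrix.add_apply]; split_ifs <;> simp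
  have evenP_smul (c : K) (A : gl K m n) : evenP K (c • A) = c • evenP K A := by
    ext i j; simp only [evenP, Matrix.of_apply, Matrix.smul_apply]; split_ifs <;> simp
  have oddP_smul (c : K) (A : gl K m n) : oddP K (c • A) = c • oddP K A := by
    ext i j; simp only [oddP, Matrix.of_apply, Matrix.smul_apply]; split_ifs <;> simp
  LinearMap.mk₂ K (sbr K)
    (fun A A' B => by
      simp only [sbr, evenP_add, oddP_add, add_mul, mul_add]; abel)
    (fun c A B => by
      simp only [sbr, evenP_smul, oddP_smul, smul_mul_assoc, mul_smul_comm, smul_sub, smul_add])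
    (fun A B B' => by
      simp only [sbr, evenP_add, oddP_add, add_mul, mul_add]; abel)
    (fun c A B => by
      simp only [sbr, evenP_smul, oddP_smul, smul_mul_assoc, mul_smul_comm, smul_sub, smul_add])

@[simp] theorem sbrBilin_apply (A B : gl K m n) : sbrBilin m n A B = sbr K A B := rfl

/-- The supertrace as a linear form. -/
def strLin (m n : ℕ) : gl K m n →ₗ[K] K where
  toFun := str K
  map_add' A B := by simp [str, mul_add, Finset.sum_add_distrib]
  map_smul' c A := by simp [str, mul_left_comm, Finset.mul_sum]

@[simp] theorem strLin_apply (A : gl K m n) : strLin m n A = str K A := rfl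

theorem bilin_ext {F G : gl K m n →ₗ[K] gl K m n →ₗ[K] K}
    (h : ∀ i j k l, F E[i, j] E[k, l] = G E[i, j] E[k, l]) : F = G := by
  refine Matrix.ext_linearMap K fun i j => LinearMap.ext_ring ?_
  refine Matrix.ext_linearMap K fun k l => LinearMap.ext_ring ?_
  exact h i j k l

theorem isHom_single_s11 (i j : Fin (m + n)) : IsHom K (par m n i + par m n j) (E[i, j]) := by
  intro a b h
  by_cases hab : i = a ∧ j = b
  · rw [hab.1, hab.2]
  · exact absurd (Matrix.single_apply_of_ne _ _ _ _ _ hab) h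

theorem IsHom.evenP_eq {p : ZMod 2} {A : gl K m n} (hA : IsHom K p A) :
    evenP K A = if p = 0 then A else 0 := by
  ext i j
  have h := hA i j
  have h2 : par m n i = par m n j ↔ par m n i + par m n j = 0 := by
    generalize par m n i = a; generalize par m n j = b; revert a b; decide
  simp only [evenP, Matrix.of_apply, h2]
  by_cases h0 : A i j = 0
  · split_ifs <;> simp [h0]
  · rw [h h0]; split_ifs <;> rfl

theorem IsHom.oddP_eq {p : ZMod 2} {A : gl K m n} (hA : IsHom K p A) :
    oddP K A = if p = 0 then 0 else A := by
  ext i j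
  have h := hA i j
  have h2 : par m n i = par m n j ↔ par m n i + par m n j = 0 := by
    generalize par m n i = a; generalize par m n j = b; revert a b; decide
  simp only [oddP, Matrix.of_apply, h2]
  by_cases h0 : A i j = 0
  · split_ifs <;> simp [h0]
  · rw [h h0]; split_ifs <;> rfl

theorem IsHom.sbr_eq {p q : ZMod 2} {A B : gl K m n} (hA : IsHom K p A) (hB : IsHom K q B) :
    sbr K A B = A * B - sg K (p * q) • (B * A) := by
  have h : p = 0 ∨ p = 1 := by clear hA; revert p; decide
  have h' : q = 0 ∨ q = 1 := by clear hB; revert q; decide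
  rw [sbr, hB.evenP_eq, hB.oddP_eq, hA.evenP_eq, hA.oddP_eq]
  rcases h with rfl | rfl <;> rcases h' with rfl | rfl <;> simp [sg]

theorem sbr_single (i j k l : Fin (m + n)) :
    sbr K (E[i, j]) (E[k, l]) = (if j = k then E[i, l] else 0) -
      sg K ((par m n i + par m n j) * (par m n k + par m n l)) • (if l = i then E[k, j] else 0) := by
  rw [(isHom_single_s11 i j).sbr_eq (isHom_single_s11 k l)]
  congr 2 <;> split_ifs with h <;> simp [h]

theorem str_single (i j : Fin (m + n)) :
    str K (E[i, j]) = if i = j then sg K (par m n i) else 0 := by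
  simp only [str, Matrix.single_apply]
  split_ifs with h
  · subst h; simp
  · refine Finset.sum_eq_zero fun x _ => ?_
    rw [if_neg, mul_zero]
    rintro ⟨rfl, rfl⟩; exact h rfl

theorem str_sbr (A B : gl K m n) : str K (sbr K A B) = 0 := by
  suffices h : (sbrBilin m n).compr₂ (strLin m n) = (0 : gl K m n →ₗ[K] gl K m n →ₗ[K] K) from
    LinearMap.congr_fun₂ h A B
  refine bilin_ext fun i j k l => ?_
  simp only [LinearMap.compr₂_apply, sbrBilin_apply, LinearMap.zero_apply]
  have h := sbr_single (K := K) i j k l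
  rw [h, map_sub, map_smul]
  have h1 := str_single (K := K) i l
  have h2 := str_single (K := K) k j
  have h0 : str K (0 : gl K m n) = 0 := map_zero (strLin m n)
  by_cases hjk : j = k <;> by_cases hli : l = i
  · subst hjk hli
    simp only [if_true, strLin_apply, h1, h2, smul_eq_mul]
    have : (par m n l + par m n j) * (par m n j + par m n l) = par m n l + par m n j := by
      rw [add_comm (par m n j), zmod_two_mul_self]
    rw [this, sg_add, mul_assoc, sg_mul_self, mul_one, sub_self]
  · simp [hjk, hli, h1, Ne.symm hli, h0]
  · simp [hjk, hli, h2, Ne.symm hjk, h0]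
  · simp [hjk, hli, h0]

theorem isHom_one : IsHom K 0 (1 : gl K m n) := by
  intro i j h
  by_cases hij : i = j
  · rw [hij, zmod_two_add_self]
  · exact absurd (Matrix.one_apply_ne hij) h

theorem sbr_one_right (A : gl K m n) : sbr K A 1 = 0 := by
  simp [sbr, isHom_one.evenP_eq, isHom_one.oddP_eq]

theorem sbr_one_left (B : gl K m n) : sbr K 1 B = 0 := by
  have : evenP K B + oddP K B = B := by
    ext i j; simp only [evenP, oddP, Matrix.of_apply, Matrix.add_apply]; split_ifs <;> simp
  simp only [sbr, isHom_one.evenP_eq, isHom_one.oddP_eq, if_true, mul_one, one_mul, mul_zero,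
    add_zero]
  rw [sub_sub, this, sub_self]

/-- `F` is super-skew-symmetric on homogeneous elements of `gl(m|n)`. -/
def IsSuperSkew (F : gl K m n →ₗ[K] gl K m n →ₗ[K] K) : Prop :=
  ∀ (p q : ZMod 2) (A B : gl K m n), IsHom K p A → IsHom K q B →
    F B A = -(sg K (p * q) * F A B)

/-- `F` satisfies the cyclic cocycle identity on homogeneous elements of `gl(m|n)`. -/
def IsSuperCocycle (F : gl K m n →ₗ[K] gl K m n →ₗ[K] K) : Prop :=
  ∀ (p q r : ZMod 2) (A B C : gl K m n), IsHom K p A → IsHom K q B → IsHom K r C →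
    sg K (p * r) * F (sbr K A B) C + sg K (q * p) * F (sbr K B C) A +
      sg K (r * q) * F (sbr K C A) B = 0

variable {F : gl K m n →ₗ[K] gl K m n →ₗ[K] K}

theorem IsSuperSkew.single (hs : IsSuperSkew F) (i j k l : Fin (m + n)) :
    F (E[k, l]) (E[i, j]) =
      -(sg K ((par m n i + par m n j) * (par m n k + par m n l)) * F (E[i, j]) (E[k, l])) :=
  hs _ _ _ _ (isHom_single_s11 i j) (isHom_single_s11 k l)

/-- Invariance of a cocycle under the diagonal matrix unit `E a a`. -/
theorem IsSuperCocycle.diag (hs : IsSuperSkew F) (hc : IsSuperCocycle F)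
    (a i j k l : Fin (m + n)) :
    ((if a = i then 1 else 0) - (if a = j then 1 else 0) + (if a = k then 1 else 0)
      - (if a = l then 1 else 0)) * F (E[i, j]) (E[k, l]) =
      (if j = k then F (E[a, a]) (E[i, l]) else 0) -
        sg K ((par m n i + par m n j) * (par m n k + par m n l)) *
          (if l = i then F (E[a, a]) (E[k, j]) else 0) := by
  have haa : IsHom K 0 (E[a, a]) := by
    have := isHom_single_s11 (K := K) a a
    rwa [zmod_two_add_self] at this
  have hx := isHom_single_s11 (K := K) i j
  have hy := isHom_single_s11 (K := K) k l
  have h1 : sbr K (E[a, a]) (E[i, j]) =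
      ((if a = i then 1 else 0) - (if a = j then 1 else 0) : K) • E[i, j] := by
    rw [sbr_single, zmod_two_add_self, zero_mul, sg_zero, one_smul, sub_smul]
    congr 1
    · split_ifs with h
      · rw [h, one_smul]
      · rw [zero_smul]
    · by_cases h : a = j
      · simp [h]
      · simp [h, Ne.symm h]
  have h2 : sbr K (E[k, l]) (E[a, a]) =
      ((if a = l then 1 else 0) - (if a = k then 1 else 0) : K) • E[k, l] := by
    rw [sbr_single, zmod_two_add_self, mul_zero, sg_zero, one_smul, sub_smul]
    congr 1
    · by_cases h : a = l
      · simp [h]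
      · simp [h, Ne.symm h]
    · split_ifs with h
      · rw [h, one_smul]
      · rw [zero_smul]
  have h := hc _ _ _ _ _ _ haa hx hy
  have hxy : F (sbr K (E[i, j]) (E[k, l])) (E[a, a]) = -F (E[a, a]) (sbr K (E[i, j]) (E[k, l])) := by
    rw [sbr_single]
    have e1 := hs.single a a i l
    have e2 := hs.single a a k j
    simp only [zmod_two_add_self, zero_mul, sg_zero, one_mul] at e1 e2
    rw [map_sub, map_sub, map_smul, map_smul, LinearMap.sub_apply, LinearMap.smul_apply]
    split_ifs <;> simp only [e1, e2, map_zero, LinearMap.zero_apply, smul_eq_mul] <;>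
      ring
  rw [h1, h2, hxy, sbr_single] at h
  simp only [zero_mul, mul_zero, sg_zero, one_mul, map_smul, LinearMap.smul_apply, smul_eq_mul,
    map_sub, hs.single i j k l] at h
  have hsg := sg_mul_self (K := K) ((par m n i + par m n j) * (par m n k + par m n l))
  rw [mul_comm (par m n k + par m n l)] at h
  simp only [apply_ite (F (E[a, a])), map_zero] at h
  linear_combination h + ((if a = l then 1 else 0) - (if a = k then 1 else 0)) *
    F (E[i, j]) (E[k, l]) * hsg

theorem IsSuperCocycle.diag_diag [CharZero K] (hs : IsSuperSkew F) (hc : IsSuperCocycle F)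
    (a i : Fin (m + n)) : F (E[a, a]) (E[i, i]) = 0 := by
  have haa : F (E[a, a]) (E[a, a]) = 0 := by
    have := hs.single a a a a
    simp only [zmod_two_add_self, zero_mul, sg_zero, one_mul] at this
    exact self_eq_neg.mp this
  have h := hc.diag hs a i a a i
  simp only [if_true] at h
  rw [haa] at h
  linear_combination -h

/-- Values on matrix units of a linear form whose coboundary is `F`. -/
def primitiveCoeff (F : gl K m n →ₗ[K] gl K m n →ₗ[K] K) (o i j : Fin (m + n)) : K :=
  if i = j then F (E[i, o]) (E[o, i]) else F (E[i, i]) (E[i, j])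

theorem IsSuperCocycle.single_single [CharZero K] (hs : IsSuperSkew F) (hc : IsSuperCocycle F)
    (o i j k l : Fin (m + n)) :
    F (E[i, j]) (E[k, l]) = (if j = k then primitiveCoeff F o i l else 0) -
      sg K ((par m n i + par m n j) * (par m n k + par m n l)) *
        (if l = i then primitiveCoeff F o k j else 0) := by
  have key : ∀ i j l : Fin (m + n), i ≠ l → F (E[i, j]) (E[j, l]) = F (E[i, i]) (E[i, l]) := by
    intro i j l hil
    have h := hc.diag hs i i j j l
    simp only [if_true, if_neg hil, if_neg hil.symm] at h
    linear_combination h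
  by_cases hjk : j = k <;> by_cases hli : l = i
  · subst hjk hli
    simp only [if_true, primitiveCoeff]
    have hp : (par m n l + par m n j) * (par m n j + par m n l) = par m n l + par m n j := by
      rw [add_comm (par m n j), zmod_two_mul_self]
    rw [hp]
    by_cases hlj : l = j
    · subst hlj
      rw [hc.diag_diag hs, zmod_two_add_self, sg_zero]; ring
    by_cases hlo : l = o
    · subst hlo
      have := hs.single j l l j
      rw [add_comm (par m n j), zmod_two_mul_self] at this
      rw [hc.diag_diag hs, this]; ring
    by_cases hjo : j = o
    · subst hjo
      rw [hc.diag_diag hs]; ring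
    have h := hc _ _ _ _ _ _ (isHom_single_s11 (K := K) l j) (isHom_single_s11 j o) (isHom_single_s11 o l)
    rw [sbr_single, sbr_single, sbr_single] at h
    simp only [if_true, if_neg (Ne.symm hlo), if_neg hlj, if_neg hjo, smul_zero, sub_zero] at h
    rw [hs.single l j j l, hs.single j o o j] at h
    rw [hp, add_comm (par m n o) (par m n j), zmod_two_mul_self] at h
    revert h
    generalize F (E[l, o]) (E[o, l]) = x
    generalize F (E[l, j]) (E[j, l]) = y
    generalize F (E[j, o]) (E[o, j]) = z
    generalize par m n l = a
    generalize par m n j = b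
    generalize par m n o = c
    have h01 : ∀ p : ZMod 2, p = 0 ∨ p = 1 := by decide
    have h11 : (1 + 1 : ZMod 2) = 0 := by decide
    rcases h01 a with rfl | rfl <;> rcases h01 b with rfl | rfl <;>
      rcases h01 c with rfl | rfl <;> simp [sg, h11] <;> intro h <;>
      first | linear_combination h | linear_combination -h
  · subst hjk
    simp only [if_true, if_neg hli, primitiveCoeff, if_neg (Ne.symm hli), key i j l (Ne.symm hli)]
    ring
  · subst hli
    rw [hs.single k l l j, key k l j (Ne.symm hjk), mul_comm (par m n k + par m n l)]
    simp only [if_true, if_neg hjk, primitiveCoeff, if_neg (Ne.symm hjk)]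
    ring
  · simp only [if_neg hjk, if_neg hli, mul_zero, sub_zero]
    have h := fun a => hc.diag hs a i j k l
    simp only [if_neg hjk, if_neg hli, mul_zero, sub_zero] at h
    by_cases hij : i = j
    · subst hij
      by_cases hkl : k = l
      · subst hkl; exact hc.diag_diag hs _ _
      · have := h k
        simp only [if_neg hkl, if_true] at this
        linear_combination this
    · have := h i
      simp only [if_neg hij, if_neg (Ne.symm hli), if_true] at this
      by_cases hik : i = k
      · simp only [if_pos hik] at this
        linear_combination this / 2
      · simp only [if_neg hik] at this
        linear_combination this

/-- Over a field of characteristic zero, every super-skew-symmetric `2`-cocycle on `gl(m|n)`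
with values in the trivial module is a coboundary. -/
theorem IsSuperCocycle.exists_primitive [CharZero K] (hs : IsSuperSkew F)
    (hc : IsSuperCocycle F) (o : Fin (m + n)) :
    ∃ φ : gl K m n →ₗ[K] K, ∀ A B, F A B = φ (sbr K A B) := by
  let φ : gl K m n →ₗ[K] K :=
    { toFun := fun A => ∑ i, ∑ j, A i j * primitiveCoeff F o i j
      map_add' := fun A B => by simp [add_mul, Finset.sum_add_distrib]
      map_smul' := fun c A => by simp [mul_assoc, Finset.mul_sum] }
  have hφ : ∀ i j, φ (Matrix.single i j 1) = primitiveCoeff F o i j := by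
    intro i j
    change ∑ a, ∑ b, Matrix.single i j (1 : K) a b * primitiveCoeff F o a b = _
    rw [Finset.sum_eq_single i, Finset.sum_eq_single j]
    · simp
    · intro b _ hb; simp [Ne.symm hb]
    · simp
    · intro a _ ha; simp [Ne.symm ha]
    · simp
  refine ⟨φ, fun A B => ?_⟩
  suffices h : F = (sbrBilin m n).compr₂ φ from LinearMap.congr_fun₂ h A B
  refine bilin_ext fun i j k l => ?_
  simp only [LinearMap.compr₂_apply, sbrBilin_apply]
  have h := sbr_single (K := K) i j k l
  rw [h, map_sub, map_smul, apply_ite φ, apply_ite φ, map_zero, hφ, hφ, smul_eq_mul]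
  exact hc.single_single hs o i j k l

theorem str_one_three_two : str K (1 : gl K 3 2) = 1 := by
  simp [str, Fin.sum_univ_succ, par, sg]

/-- The projection of `gl(3|2)` onto `sl(3|2)` along the scalar matrices. -/
def slProj : gl K 3 2 →ₗ[K] sl K 3 2 :=
  LinearMap.codRestrict (sl K 3 2) (LinearMap.id - (strLin 3 2).smulRight 1) fun A => by
    change strLin 3 2 (A - strLin 3 2 A • 1) = 0
    rw [map_sub, map_smul, strLin_apply 1, str_one_three_two, smul_eq_mul, mul_one, sub_self]

theorem coe_slProj (A : gl K 3 2) : (slProj A : gl K 3 2) = A - str K A • 1 := rfl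

theorem slProj_coe (A : sl K 3 2) : slProj (A : gl K 3 2) = A := by
  have h : str K (A : gl K 3 2) = 0 := A.2
  ext1
  rw [coe_slProj, h, zero_smul, sub_zero]

theorem IsHom.slProj {p : ZMod 2} {A : gl K 3 2} (hA : IsHom K p A) :
    IsHom K p (slProj A : gl K 3 2) := by
  rw [coe_slProj]
  by_cases hp : p = 0
  · subst hp
    intro i j h
    by_cases hij : i = j
    · rw [hij, zmod_two_add_self]
    · exact hA i j (by simpa [Matrix.one_apply_ne hij] using h)
  · have : str K A = 0 := Finset.sum_eq_zero fun i _ => by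
      by_contra h
      exact hp ((hA i i (right_ne_zero_of_mul h)).symm.trans (zmod_two_add_self _))
    rwa [this, zero_smul, sub_zero]

theorem coe_slProj_sbr (A B : gl K 3 2) :
    (slProj (sbr K A B) : gl K 3 2) = sbr K (slProj A : gl K 3 2) (slProj B : gl K 3 2) := by
  simp only [coe_slProj, str_sbr, zero_smul, sub_zero]
  simp only [← sbrBilin_apply, map_sub, map_smul, LinearMap.sub_apply, LinearMap.smul_apply]
  simp [sbr_one_left, sbr_one_right]

end Supercocycle

/-- Let `L = sl(3|2)`.  Every super-skew-symmetric bilinear map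
`f : L × L → 𝕂` satisfying the cyclic cocycle identity is of the form `f(A,B) = φ(⟨A,B⟩)`
for some linear map `φ : L → 𝕂`; equivalently, `H²(sl(3|2), 𝕂) = 0` for the trivial module. -/
theorem second_cohomology_trivial_module_sl_3_2
    (K : Type) [Field K] [IsAlgClosed K] [CharZero K]
    (f : ↥(sl K 3 2) →ₗ[K] ↥(sl K 3 2) →ₗ[K] K)
    (hskew : ∀ (pA pB : ZMod 2) (A B : ↥(sl K 3 2)),
      IsHom K pA (A : gl K 3 2) → IsHom K pB (B : gl K 3 2) →
      f B A = -(sg K (pA * pB) * f A B))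
    (hcocycle : ∀ (pA pB pC : ZMod 2) (A B C AB BC CA : ↥(sl K 3 2)),
      IsHom K pA (A : gl K 3 2) → IsHom K pB (B : gl K 3 2) → IsHom K pC (C : gl K 3 2) →
      (AB : gl K 3 2) = sbr K ↑A ↑B → (BC : gl K 3 2) = sbr K ↑B ↑C →
      (CA : gl K 3 2) = sbr K ↑C ↑A →
      sg K (pA * pC) * f AB C + sg K (pB * pA) * f BC A + sg K (pC * pB) * f CA B = 0) :
    ∃ φ : ↥(sl K 3 2) →ₗ[K] K, ∀ (A B AB : ↥(sl K 3 2)),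
      (AB : gl K 3 2) = sbr K ↑A ↑B → f A B = φ AB := by
  have hs : IsSuperSkew (f.compl₁₂ slProj slProj) := fun p q A B hA hB =>
    hskew p q _ _ hA.slProj hB.slProj
  have hc : IsSuperCocycle (f.compl₁₂ slProj slProj) := fun p q r A B C hA hB hC =>
    hcocycle p q r _ _ _ _ _ _ hA.slProj hB.slProj hC.slProj (coe_slProj_sbr A B)
      (coe_slProj_sbr B C) (coe_slProj_sbr C A)
  obtain ⟨φ, hφ⟩ := hc.exists_primitive hs 0
  refine ⟨φ ∘ₗ (sl K 3 2).subtype, fun A B AB hAB => ?_⟩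
  have h := hφ A B
  rw [LinearMap.compl₁₂_apply, slProj_coe, slProj_coe] at h
  rw [h, ← hAB]
  rfl
end
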